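/- Let K be a CW complex, f : K → ℝ a function on its cells, and ν, σ, τ cells with ν ≺ σ ≺ τ, where σ ∈ C^red for a collection C containing σ and τ with f(σ) = f(τ), and suppose f is discrete Morse–Bott. If σ is upward noncritical in C then so is ν whenever ν ≺ σ and ν ∈ C; equivalently (as used in the paper's Lemma 4.1 proof): if σ ∈ C is upward noncritical and ν ∈ C satisfies ν ≺ σ, then there exists a cell σ̃ with ν ≺ σ̃ and f(ν) > f(σ̃). -/

import Mathlib

/-!
Set-based CW complexes: a CW complex is identified with the family of its cells.
Each `n`-cell `τ` has a characteristic map `charMap τ : D^n → X` (from the closed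
unit disk of `EuclideanSpace ℝ (Fin n)`), the open cells partition `X`, the closure
of each cell is the image of the closed disk, the boundary sphere is mapped into
finitely many cells of strictly lower dimension (closure finiteness), and `X`
carries the weak topology determined by the closed cells.
-/

open Metric Set

structure CWComplexCells (X : Type) [TopologicalSpace X] [T2Space X] where
  /-- The (index type of the) cells of the complex. -/
  Cell : Type
  /-- The dimension of each cell. -/
  dim : Cell → ℕ
  /-- The characteristic map of each cell. -/
  charMap : (τ : Cell) → EuclideanSpace ℝ (Fin (dim τ)) → X
  charMap_continuousOn : ∀ τ, ContinuousOn (charMap τ) (closedBall 0 1)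
  charMap_injOn : ∀ τ, InjOn (charMap τ) (ball 0 1)
  /-- Distinct (open) cells are disjoint. -/
  cells_disjoint : ∀ σ τ : Cell, σ ≠ τ →
    Disjoint (charMap σ '' ball 0 1) (charMap τ '' ball 0 1)
  /-- The open cells cover the space. -/
  cells_cover : (⋃ τ : Cell, charMap τ '' ball 0 1) = univ
  /-- The closure of an open cell is the image of the closed disk. -/
  closure_cell : ∀ τ, closure (charMap τ '' ball 0 1) = charMap τ '' closedBall 0 1
  /-- Closure finiteness: the boundary sphere of each cell is mapped into a finite
  union of cells of strictly smaller dimension. -/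
  sphere_subset : ∀ τ, ∃ I : Set Cell, I.Finite ∧ (∀ σ ∈ I, dim σ < dim τ) ∧
    charMap τ '' sphere 0 1 ⊆ ⋃ σ ∈ I, charMap σ '' ball 0 1
  /-- Weak topology: a set is closed iff its intersection with each closed cell is closed. -/
  isClosed_iff : ∀ A : Set X, IsClosed A ↔ ∀ τ, IsClosed (A ∩ charMap τ '' closedBall 0 1)

namespace CWComplexCells

variable {X : Type} [TopologicalSpace X] [T2Space X] (K : CWComplexCells X)

/-- The (open) cell of `τ`, as a subset of the space. -/
def cellSet (τ : K.Cell) : Set X := K.charMap τ '' ball 0 1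

/-- `ν` is a face of `τ` (written `ν < τ`): `ν ⊆ cl(τ) \ τ`. -/
def Face (ν τ : K.Cell) : Prop :=
  K.cellSet ν ⊆ closure (K.cellSet τ) \ K.cellSet τ

/-- `ν` is a facet of `τ` (written `ν ≺ τ`): a face of codimension one. -/
def Facet (ν τ : K.Cell) : Prop := K.Face ν τ ∧ K.dim ν + 1 = K.dim τ

/-- The preimage of the cell `σ` under the characteristic map of `τ`,
inside the closed disk. -/
def preim (σ τ : K.Cell) : Set (EuclideanSpace ℝ (Fin (K.dim τ))) :=
  closedBall 0 1 ∩ K.charMap τ ⁻¹' K.cellSet σ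

/-- `σ` is a regular face of `τ`: `σ < τ`, the restriction
`charMap τ : charMap τ ⁻¹(σ) → σ` is a homeomorphism, and the closure of
`charMap τ ⁻¹(σ)` is a closed `(dim σ)`-ball. -/
def RegularFace (σ τ : K.Cell) : Prop :=
  K.Face σ τ ∧
  (∃ e : K.preim σ τ ≃ₜ K.cellSet σ,
    ∀ x : K.preim σ τ, (e x : X) = K.charMap τ (x : EuclideanSpace ℝ (Fin (K.dim τ)))) ∧
  Nonempty ((closure (K.preim σ τ)) ≃ₜ
    (closedBall (0 : EuclideanSpace ℝ (Fin (K.dim σ))) 1))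

/-- `σ` is an irregular face of `τ`. -/
def IrregularFace (σ τ : K.Cell) : Prop := K.Face σ τ ∧ ¬ K.RegularFace σ τ

/-- `σ` is a regular facet of `τ`. -/
def RegularFacet (σ τ : K.Cell) : Prop := K.RegularFace σ τ ∧ K.dim σ + 1 = K.dim τ

/-- `σ` is an irregular facet of `τ`. -/
def IrregularFacet (σ τ : K.Cell) : Prop := K.Facet σ τ ∧ ¬ K.RegularFace σ τ

/-- The set of upper noncritical neighbours of `σ`:
`(k+1)`-cells `τ` with `σ ≺ τ` and `f σ ≥ f τ`. -/
def Uset (f : K.Cell → ℝ) (σ : K.Cell) : Set K.Cell :=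
  {τ | K.Facet σ τ ∧ f σ ≥ f τ}

/-- The set of lower noncritical neighbours of `σ`:
`(k-1)`-cells `ν` with `ν ≺ σ` and `f ν ≥ f σ`. -/
def Dset (f : K.Cell → ℝ) (σ : K.Cell) : Set K.Cell :=
  {ν | K.Facet ν σ ∧ f ν ≥ f σ}

/-- `U(σ)`. -/
noncomputable def U (f : K.Cell → ℝ) (σ : K.Cell) : ℕ∞ := (K.Uset f σ).encard

/-- `D(σ)`. -/
noncomputable def D (f : K.Cell → ℝ) (σ : K.Cell) : ℕ∞ := (K.Dset f σ).encard

/-- `f` is a discrete Morse function. -/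
def DiscreteMorse (f : K.Cell → ℝ) : Prop :=
  ∀ σ : K.Cell,
    (∀ τ, K.IrregularFacet σ τ → f σ < f τ) ∧
    K.U f σ ≤ 1 ∧
    (∀ ν, K.IrregularFacet ν σ → f ν < f σ) ∧
    K.D f σ ≤ 1

/-- Two cells are adjacent if one is a facet of the other. -/
def Adjacent (σ τ : K.Cell) : Prop := K.Facet σ τ ∨ K.Facet τ σ

/-- There is an `r`-path from `σ` to `τ`: a sequence of cells on the level set
`f⁻¹(r)` in which consecutive cells are facets of one another. -/
def RPath (f : K.Cell → ℝ) (r : ℝ) (σ τ : K.Cell) : Prop :=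
  f σ = r ∧ Relation.ReflTransGen (fun a b => K.Adjacent a b ∧ f b = r) σ τ

/-- A family of cells contained in one level set of `f` whose members are
pairwise joined by `c`-paths. -/
def IsPreCollection (f : K.Cell → ℝ) (C : Set K.Cell) : Prop :=
  ∃ c : ℝ, (∀ σ ∈ C, f σ = c) ∧ ∀ σ ∈ C, ∀ τ ∈ C, K.RPath f c σ τ

/-- A collection for `f`: a maximal family of cells contained in one level set
of `f` whose members are pairwise joined by `c`-paths. -/
def IsCollection (f : K.Cell → ℝ) (C : Set K.Cell) : Prop :=
  K.IsPreCollection f C ∧ ∀ C', C ⊆ C' → K.IsPreCollection f C' → C' = C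

/-- The set counted by `U^C(σ)`. -/
def UCset (f : K.Cell → ℝ) (C : Set K.Cell) (σ : K.Cell) : Set K.Cell :=
  {τ | τ ∉ C ∧ K.Facet σ τ ∧ f σ ≥ f τ}

/-- The set counted by `D^C(σ)`. -/
def DCset (f : K.Cell → ℝ) (C : Set K.Cell) (σ : K.Cell) : Set K.Cell :=
  {ν | ν ∉ C ∧ K.Facet ν σ ∧ f ν ≥ f σ}

/-- `U^C(σ)`. -/
noncomputable def UC (f : K.Cell → ℝ) (C : Set K.Cell) (σ : K.Cell) : ℕ∞ :=
  (K.UCset f C σ).encard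

/-- `D^C(σ)`. -/
noncomputable def DC (f : K.Cell → ℝ) (C : Set K.Cell) (σ : K.Cell) : ℕ∞ :=
  (K.DCset f C σ).encard

/-- `f` is a discrete Morse–Bott function. -/
def DiscreteMorseBott (f : K.Cell → ℝ) : Prop :=
  ∀ C : Set K.Cell, K.IsCollection f C → ∀ σ ∈ C,
    (∀ τ, K.IrregularFace σ τ → f σ < f τ) ∧
    K.UC f C σ ≤ 1 ∧
    (∀ ν, K.IrregularFace ν σ → f ν < f σ) ∧
    K.DC f C σ ≤ 1

/-- The reduced collection `C^red`: delete from `C` all upward noncritical cells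
(those with `U^C(σ) = 1`) and all downward noncritical cells (those with `D^C(σ) = 1`). -/
def red (f : K.Cell → ℝ) (C : Set K.Cell) : Set K.Cell :=
  {σ ∈ C | K.UC f C σ ≠ 1 ∧ K.DC f C σ ≠ 1}

end CWComplexCells

section Brouwer
open MeasureTheory Filter Topology

variable {E : Type*} [NormedAddCommGroup E] [InnerProductSpace ℝ E] [FiniteDimensional ℝ E]

lemma det_interp (t : ℕ → ℝ) (ht : Function.Injective t) :
    ∃ c : ℕ → ℝ, ∀ A : E →L[ℝ] E, (1 + A).det =
      ∑ i ∈ Finset.range (Module.finrank ℝ E + 1), c i * (1 + t i • A).det := by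
  classical
  set s := Finset.range (Module.finrank ℝ E + 1) with hs
  refine ⟨fun i => (Lagrange.basis s t i).eval 1, fun A => ?_⟩
  let b := Module.finBasis ℝ E
  let M := LinearMap.toMatrix b b (A : E →ₗ[ℝ] E)
  let P : Polynomial ℝ := Matrix.det ((Polynomial.X : Polynomial ℝ) • M.map Polynomial.C
    + (1 : Matrix _ _ ℝ).map Polynomial.C)
  have hP : ∀ r : ℝ, P.eval r = (1 + r • A).det := by
    intro r
    have h1 : (1 + r • A).det = Matrix.det (1 + r • M) := by
      rw [ContinuousLinearMap.det, ← LinearMap.det_toMatrix b]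
      congr 1
      have : ((1 + r • A : E →L[ℝ] E) : E →ₗ[ℝ] E) = 1 + r • (A : E →ₗ[ℝ] E) := rfl
      rw [this, map_add, map_smul, LinearMap.toMatrix_one]
    rw [h1]
    simp only [P]
    rw [← Polynomial.coe_evalRingHom, RingHom.map_det]
    congr 1
    ext i j
    simp [Matrix.map_apply, Matrix.one_apply, add_comm]
    split_ifs <;> simp [mul_comm]
  have hdeg : P.degree < s.card := by
    have := Polynomial.natDegree_det_X_add_C_le M (1 : Matrix _ _ ℝ)
    simp only [Fintype.card_fin] at this
    refine lt_of_le_of_lt Polynomial.degree_le_natDegree ?_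
    rw [hs, Finset.card_range]
    exact_mod_cast Nat.lt_succ_of_le this
  have := Lagrange.eq_interpolate (s := s) (v := t) ht.injOn hdeg
  have h1 := hP 1
  rw [one_smul] at h1
  rw [← h1]
  conv_lhs => rw [this]
  rw [Lagrange.interpolate_apply, Polynomial.eval_finsetSum]
  refine Finset.sum_congr rfl fun i _ => ?_
  simp only [Polynomial.eval_mul, Polynomial.eval_C, hP]
  ring

/-- No `C¹` retraction of a ball onto its boundary sphere. -/
lemma no_smooth_retract (R : ℝ) (hR : 0 < R) (r : E → E) (hr : ContDiff ℝ 1 r)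
    (hn : ∀ x, ‖r x‖ = R) (hid : ∀ x, ‖x‖ = R → r x = x) : False := by
  borelize E
  set v : E → E := fun x => r x - x with hv
  have hvc : ContDiff ℝ 1 v := hr.sub contDiff_id
  have hvd : ∀ x, HasStrictFDerivAt v (fderiv ℝ v x) x := fun x =>
    hvc.contDiffAt.hasStrictFDerivAt one_ne_zero
  have hv'c : Continuous (fderiv ℝ v) := hvc.continuous_fderiv one_ne_zero
  have hcpt : IsCompact (closedBall (0 : E) R) := isCompact_closedBall 0 R
  -- Lipschitz bound
  obtain ⟨L, hL⟩ : ∃ L : ℝ, ∀ x ∈ closedBall (0 : E) R, ‖fderiv ℝ v x‖ ≤ L :=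
    hcpt.exists_bound_of_continuousOn hv'c.continuousOn
  have hLip : ∀ x ∈ closedBall (0 : E) R, ∀ y ∈ closedBall (0 : E) R,
      ‖v y - v x‖ ≤ L * ‖y - x‖ := fun x hx y hy =>
    (convex_closedBall (0 : E) R).norm_image_sub_le_of_norm_hasFDerivWithin_le
      (fun z _ => (hvd z).hasFDerivAt.hasFDerivWithinAt) hL hx hy
  have hL0 : 0 ≤ L := (norm_nonneg _).trans (hL 0 (by simp [hR.le]))
  -- det positive for small t
  have hdetc : Continuous fun p : ℝ × E => (1 + p.1 • fderiv ℝ v p.2).det :=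
    ContinuousLinearMap.continuous_det.comp (by fun_prop)
  obtain ⟨t₀, ht₀, hdet⟩ : ∃ t₀ : ℝ, 0 < t₀ ∧ ∀ t : ℝ, 0 ≤ t → t < t₀ → ∀ x ∈ closedBall (0 : E) R,
      0 < (1 + t • fderiv ℝ v x).det := by
    obtain ⟨u, w, hu, hw, hu0, hw0, huw⟩ := generalized_tube_lemma
      (isCompact_singleton (x := (0 : ℝ))) hcpt
      (n := {p : ℝ × E | 0 < (1 + p.1 • fderiv ℝ v p.2).det})
      (isOpen_lt continuous_const hdetc) (by
        rintro ⟨a, x⟩ ⟨ha, hx⟩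
        simp only [mem_singleton_iff] at ha
        subst ha
        simp [ContinuousLinearMap.det])
    obtain ⟨ε, hε, hεu⟩ := Metric.isOpen_iff.1 hu 0 (hu0 rfl)
    refine ⟨ε, hε, fun t ht hte x hx => ?_⟩
    exact huw (show (t, x) ∈ u ×ˢ w from
      ⟨hεu (by simp [abs_of_nonneg ht, hte]), hw0 hx⟩)
  set T := min t₀ (min (1 / (L + 1)) 1) with hT
  have hTpos : 0 < T := by positivity
  -- key integral identity
  have key : ∀ t : ℝ, 0 < t → t < T →
      ∫ x in ball (0 : E) R, (1 + t • fderiv ℝ v x).det = volume.real (ball (0 : E) R) := by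
    intro t ht htT
    have h1 : t < t₀ := htT.trans_le (min_le_left _ _)
    have h2 : t < 1 / (L + 1) := htT.trans_le ((min_le_right _ _).trans (min_le_left _ _))
    have h3 : t < 1 := htT.trans_le ((min_le_right _ _).trans (min_le_right _ _))
    have htL : t * L < 1 := by
      rw [lt_div_iff₀ (by positivity)] at h2
      nlinarith
    set g : E → E := fun x => x + t • v x with hg
    have hgd : ∀ x, HasStrictFDerivAt g (1 + t • fderiv ℝ v x) x := fun x =>
      (hasStrictFDerivAt_id x).add ((hvd x).const_smul t)
    have hgc : Continuous g := continuous_id.add (hvc.continuous.const_smul t)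
    have hinj : InjOn g (closedBall (0 : E) R) := by
      intro x hx y hy hxy
      by_contra hne
      have h4 : y - x = - (t • (v y - v x)) := by
        simp only [hg] at hxy
        rw [smul_sub, eq_neg_iff_add_eq_zero]
        have : y - x + (t • v y - t • v x) = (y + t • v y) - (x + t • v x) := by abel
        rw [this, hxy, sub_self]
      have h5 : ‖y - x‖ ≤ t * (L * ‖y - x‖) := by
        conv_lhs => rw [h4, norm_neg, norm_smul, Real.norm_of_nonneg ht.le]
        exact mul_le_mul_of_nonneg_left (hLip x hx y hy) ht.le
      have h6 : 0 < ‖y - x‖ := norm_pos_iff.2 (sub_ne_zero.2 (Ne.symm hne))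
      nlinarith
    have hgeq : ∀ x, g x = (1 - t) • x + t • r x := by
      intro x; simp only [hg, hv, smul_sub, sub_smul, one_smul]; abel
    have hmap : ∀ x ∈ ball (0 : E) R, g x ∈ ball (0 : E) R := by
      intro x hx
      rw [mem_ball_zero_iff] at hx ⊢
      rw [hgeq]
      calc ‖(1 - t) • x + t • r x‖ ≤ ‖(1 - t) • x‖ + ‖t • r x‖ := norm_add_le _ _
        _ = (1 - t) * ‖x‖ + t * R := by
          rw [norm_smul, norm_smul, hn, Real.norm_of_nonneg ht.le,
            Real.norm_of_nonneg (by linarith)]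
        _ < R := by nlinarith
    have hsph : ∀ x, ‖x‖ = R → g x = x := by
      intro x hx; simp [hg, hv, hid x hx]
    have himo : IsOpen (g '' ball (0 : E) R) := by
      rw [isOpen_iff_mem_nhds]
      rintro _ ⟨x, hx, rfl⟩
      have hne := (hdet t ht.le h1 x (ball_subset_closedBall hx)).ne'
      have hr : (1 + t • fderiv ℝ v x).range = ⊤ := by
        have : IsUnit ((1 + t • fderiv ℝ v x : E →L[ℝ] E) : E →ₗ[ℝ] E) :=
          (LinearMap.isUnit_iff_isUnit_det _).2 (isUnit_iff_ne_zero.2 hne)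
        exact (LinearMap.isUnit_iff_range_eq_top _).1 this
      rw [← (hgd x).map_nhds_eq_of_surj hr]
      exact image_mem_map (isOpen_ball.mem_nhds hx)
    have himg : g '' ball (0 : E) R = ball (0 : E) R := by
      refine Subset.antisymm (by rintro _ ⟨x, hx, rfl⟩; exact hmap x hx) ?_
      have hpre : IsPreconnected (ball (0 : E) R) := (convex_ball _ _).isPreconnected
      have hcl : IsClosed (g '' closedBall (0 : E) R) := (hcpt.image hgc).isClosed
      have hsub : ball (0 : E) R ⊆ g '' ball (0 : E) R ∪ (g '' closedBall (0 : E) R)ᶜ := by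
        intro y hy
        by_cases h : y ∈ g '' closedBall (0 : E) R
        · left
          obtain ⟨x, hx, rfl⟩ := h
          refine ⟨x, ?_, rfl⟩
          rw [mem_closedBall_zero_iff] at hx
          rcases hx.lt_or_eq with h | h
          · simpa using h
          · rw [hsph x h, mem_ball_zero_iff] at hy; linarith
        · exact Or.inr h
      have hdisj : Disjoint (g '' ball (0 : E) R) (g '' closedBall (0 : E) R)ᶜ := by
        rw [disjoint_compl_right_iff_subset]
        exact image_mono ball_subset_closedBall
      rcases hpre.subset_or_subset himo hcl.isOpen_compl hdisj hsub with h | h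
      · exact h
      · exfalso
        have h0 : (0 : E) ∈ ball (0 : E) R := by simpa using hR
        exact h (hmap 0 h0) ⟨0, ball_subset_closedBall h0, rfl⟩
    have := integral_image_eq_integral_abs_det_fderiv_smul (volume : Measure E)
      (measurableSet_ball (x := (0 : E)) (ε := R))
      (fun x _ => (hgd x).hasFDerivAt.hasFDerivWithinAt) (hinj.mono ball_subset_closedBall)
      (fun _ => (1 : ℝ))
    rw [himg] at this
    simp only [smul_eq_mul, mul_one] at this
    rw [setIntegral_const, smul_eq_mul, mul_one] at this
    rw [this]
    refine setIntegral_congr_fun measurableSet_ball fun x hx => ?_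
    exact (abs_of_pos (hdet t ht.le h1 x (ball_subset_closedBall hx))).symm
  -- interpolation
  set t : ℕ → ℝ := fun i => T / (i + 2) with htdef
  have htinj : Function.Injective t := by
    intro i j hij
    simp only [htdef] at hij
    rw [div_eq_div_iff (by positivity) (by positivity)] at hij
    have := mul_left_cancel₀ hTpos.ne' hij
    have : (i : ℝ) = j := by linarith
    exact_mod_cast this
  have htpos : ∀ i, 0 < t i := fun i => by positivity
  have htlt : ∀ i, t i < T := fun i => by
    simp only [htdef]
    have : (0 : ℝ) ≤ i := Nat.cast_nonneg i
    exact div_lt_self hTpos (by linarith)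
  obtain ⟨c, hc⟩ := det_interp (E := E) t htinj
  have hint : ∀ s : ℝ, IntegrableOn (fun x => (1 + s • fderiv ℝ v x).det) (ball (0 : E) R) := by
    intro s
    have : Continuous fun x => (1 + s • fderiv ℝ v x).det :=
      hdetc.comp (continuous_const.prodMk continuous_id)
    exact (this.continuousOn.integrableOn_compact hcpt).mono_set ball_subset_closedBall
  have hsum : ∑ i ∈ Finset.range (Module.finrank ℝ E + 1), c i = 1 := by
    have := hc 0
    simpa [ContinuousLinearMap.det] using this.symm
  have hI : ∫ x in ball (0 : E) R, (1 + fderiv ℝ v x).det = volume.real (ball (0 : E) R) := by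
    have hfe : (fun x => (1 + fderiv ℝ v x).det) = fun x =>
        ∑ i ∈ Finset.range (Module.finrank ℝ E + 1), c i * (1 + t i • fderiv ℝ v x).det :=
      funext fun x => hc _
    rw [hfe]
    rw [integral_finsetSum]
    · simp_rw [integral_const_mul, key _ (htpos _) (htlt _)]
      rw [← Finset.sum_mul, hsum, one_mul]
    · intro i _
      exact (hint (t i)).const_mul (c i)
  have hz : ∀ x, (1 + fderiv ℝ v x).det = 0 := by
    intro x
    have hrd : HasFDerivAt r (1 + fderiv ℝ v x) x := by
      have h := (hasFDerivAt_id x).add (hvd x).hasFDerivAt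
      refine h.congr_of_eventuallyEq (Eventually.of_forall fun y => ?_)
      simp [hv]
    by_contra hne
    have hu : IsUnit ((1 + fderiv ℝ v x : E →L[ℝ] E) : E →ₗ[ℝ] E) :=
      (LinearMap.isUnit_iff_isUnit_det _).2 (isUnit_iff_ne_zero.2 hne)
    have hrg := (LinearMap.isUnit_iff_range_eq_top _).1 hu
    obtain ⟨w, hw⟩ := LinearMap.range_eq_top.1 hrg (r x)
    have h1 := hrd.norm_sq
    have h2 : (fun y => ‖r y‖ ^ 2) = fun _ => R ^ 2 := by funext y; rw [hn]
    rw [h2] at h1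
    have h3 := h1.unique (hasFDerivAt_const (R ^ 2) x)
    have h4 := congrArg (fun A : E →L[ℝ] ℝ => A w) h3
    replace hw : w + fderiv ℝ v x w = r x := hw
    simp at h4
    rw [← mul_add, ← inner_add_right, hw, real_inner_self_eq_norm_sq, hn] at h4
    exact hR.ne' (by simpa using h4)
  simp_rw [hz] at hI
  simp only [integral_zero] at hI
  have : 0 < volume.real (ball (0 : E) R) :=
    ENNReal.toReal_pos (measure_ball_pos _ _ hR).ne' measure_ball_lt_top.ne
  linarith
end Brouwer

section Brouwer2
open MeasureTheory Filter Topology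

variable {E : Type*} [NormedAddCommGroup E] [InnerProductSpace ℝ E] [FiniteDimensional ℝ E]

lemma brouwer_dir (F : E → E) (hF : ContinuousOn F (closedBall 0 1))
    (hne : ∀ x ∈ closedBall (0 : E) 1, F x ≠ 0)
    (hdir : ∀ y : E, ‖y‖ = 1 → ∀ c : ℝ, 0 < c → F y ≠ -(c • y)) : False := by
  set p : E → E := fun w => (max 1 ‖w‖)⁻¹ • w with hp
  have hmax : ∀ w : E, 0 < max 1 ‖w‖ := fun w => lt_of_lt_of_le one_pos (le_max_left _ _)
  have hpc : Continuous p :=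
    ((continuous_const.max continuous_norm).inv₀ fun w => (hmax w).ne').smul continuous_id
  have hpm : ∀ w, p w ∈ closedBall (0 : E) 1 := by
    intro w
    rw [mem_closedBall_zero_iff, norm_smul, norm_inv, Real.norm_of_nonneg (hmax w).le,
      inv_mul_le_iff₀ (hmax w), mul_one]
    exact le_max_right _ _
  set s : E → ℝ := fun w => min 1 (max 0 (‖w‖ - 1)) with hs
  have hsc : Continuous s := by fun_prop
  set G₀ : E → E := fun w => (1 - s w) • F (p w) + s w • w with hG₀
  have hFp : Continuous fun w => F (p w) := hF.comp_continuous hpc hpm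
  have hG₀c : Continuous G₀ :=
    ((continuous_const.sub hsc).smul hFp).add (hsc.smul continuous_id)
  have hG₀far : ∀ w, 2 ≤ ‖w‖ → G₀ w = w := by
    intro w hw
    have : s w = 1 := by
      simp only [hs]; rw [max_eq_right (by linarith), min_eq_left (by linarith)]
    simp [hG₀, this]
  have hG₀ne : ∀ w, G₀ w ≠ 0 := by
    intro w h0
    rcases le_or_gt ‖w‖ 1 with h1 | h1
    · have h2 : s w = 0 := by
        simp only [hs]; rw [max_eq_left (by linarith), min_eq_right (by linarith)]
      have h3 : p w = w := by simp [hp, max_eq_left h1]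
      simp only [hG₀, h2, h3] at h0
      exact hne w (by simpa using h1) (by simpa using h0)
    rcases lt_or_ge ‖w‖ 2 with h2 | h2
    · have h3 : s w = ‖w‖ - 1 := by
        simp only [hs]; rw [max_eq_right (by linarith), min_eq_right (by linarith)]
      have h4 : p w = ‖w‖⁻¹ • w := by simp [hp, max_eq_right h1.le]
      have hpos : 0 < ‖w‖ := by linarith
      have h5 : ‖p w‖ = 1 := by
        rw [h4, norm_smul, norm_inv, norm_norm, inv_mul_cancel₀ hpos.ne']
      have h6 : w = ‖w‖ • p w := by rw [h4, smul_smul, mul_inv_cancel₀ hpos.ne', one_smul]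
      have h7 : 0 < 2 - ‖w‖ := by linarith
      refine hdir (p w) h5 ((‖w‖ - 1) * ‖w‖ / (2 - ‖w‖))
        (div_pos (mul_pos (by linarith) hpos) h7) ?_
      have h8 : (2 - ‖w‖) • F (p w) = -(((‖w‖ - 1) * ‖w‖) • p w) := by
        rw [eq_neg_iff_add_eq_zero, mul_smul, ← h6]
        simp only [hG₀, h3] at h0
        rw [← h0]; congr 2; ring
      have h9 := congrArg (fun z => (2 - ‖w‖)⁻¹ • z) h8
      simp only [smul_smul, inv_mul_cancel₀ h7.ne', one_smul, smul_neg] at h9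
      rw [h9, div_eq_inv_mul]
    · rw [hG₀far w h2] at h0
      rw [h0, norm_zero] at h2; linarith
  -- compactly supported perturbation
  set D : E → E := fun w => G₀ w - w with hD
  have hDc : Continuous D := hG₀c.sub continuous_id
  have hDs : HasCompactSupport D := by
    refine HasCompactSupport.intro (isCompact_closedBall (0 : E) 2) fun w hw => ?_
    rw [mem_closedBall_zero_iff, not_le] at hw
    simp [hD, hG₀far w hw.le]
  have hDu : UniformContinuous D := hDs.uniformContinuous_of_continuous hDc
  obtain ⟨δ, hδ, hδle⟩ : ∃ δ : ℝ, 0 < δ ∧ ∀ w ∈ closedBall (0 : E) 2, δ ≤ ‖G₀ w‖ := by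
    obtain ⟨w₀, -, h⟩ := (isCompact_closedBall (0 : E) 2).exists_isMinOn ⟨0, by simp⟩
      hG₀c.norm.continuousOn
    exact ⟨‖G₀ w₀‖, norm_pos_iff.2 (hG₀ne w₀), fun w hw => h hw⟩
  obtain ⟨h, hhc, hhd⟩ := hDu.exists_contDiff_dist_le (ε := min (δ / 2) 1) (by positivity)
  have hh1 : ∀ w, ‖h w - D w‖ < δ := fun w => by
    rw [← dist_eq_norm]
    have := (hhd w).le.trans (min_le_left _ _)
    rw [dist_comm]; first | linarith | (rw [dist_comm]; linarith)
  have hh2 : ∀ w, ‖h w - D w‖ ≤ 1 := fun w => by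
    rw [← dist_eq_norm]
    have := (hhd w).le.trans (min_le_right _ _)
    rw [dist_comm]; first | linarith | (rw [dist_comm]; linarith)
  let β : ContDiffBump (0 : E) := ⟨2, 3, by norm_num, by norm_num⟩
  set G : E → E := fun w => w + β w • h w with hG
  have hGc : ContDiff ℝ 1 G :=
    contDiff_id.add ((β.contDiff).smul (hhc.of_le (by exact_mod_cast le_top)))
  have hGne : ∀ w, G w ≠ 0 := by
    intro w h0
    rcases le_or_gt ‖w‖ 2 with h1 | h1
    · have hm : w ∈ closedBall (0 : E) 2 := by simpa using h1
      have h2 : β w = 1 := β.one_of_mem_closedBall hm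
      have h3 : h w - D w = - G₀ w := by
        simp only [hG, h2, one_smul] at h0
        simp only [hD]
        rw [eq_neg_iff_add_eq_zero, ← h0]; abel
      have h4 := hh1 w
      rw [h3, norm_neg] at h4
      exact absurd (hδle w hm) (not_le.2 h4)
    · have h2 : D w = 0 := by simp [hD, hG₀far w h1.le]
      have h3 := hh2 w
      rw [h2, sub_zero] at h3
      have h4 : w = -(β w • h w) := eq_neg_of_add_eq_zero_left h0
      have h5 : ‖w‖ ≤ 1 := by
        rw [h4, norm_neg, norm_smul, Real.norm_of_nonneg β.nonneg]
        exact mul_le_one₀ β.le_one (norm_nonneg _) h3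
      linarith
  have hGid : ∀ w, ‖w‖ = 3 → G w = w := by
    intro w hw
    have : β w = 0 := β.zero_of_le_dist (by simp [hw, β])
    simp [hG, this]
  refine no_smooth_retract (E := E) 3 (by norm_num) (fun w => (3 / ‖G w‖) • G w) ?_ ?_ ?_
  · exact (contDiff_const.div (hGc.norm ℝ hGne) fun w => norm_ne_zero_iff.2 (hGne w)).smul hGc
  · intro w
    have := norm_pos_iff.2 (hGne w)
    rw [norm_smul, norm_div, norm_norm, div_mul_cancel₀ _ this.ne']; simp
  · intro w hw
    simp [hGid w hw, hw]
end Brouwer2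

section Prelim
open Filter Topology

lemma continuousOn_image_of_comp {A X Y : Type*} [TopologicalSpace A] [TopologicalSpace X]
    [TopologicalSpace Y] [T2Space A] [T2Space X] {χ : A → X} {s : Set A} (hs : IsCompact s)
    (hχ : ContinuousOn χ s) {g : X → Y} (hg : ContinuousOn (fun z => g (χ z)) s) :
    ContinuousOn g (χ '' s) := by
  rw [continuousOn_iff_isClosed]
  intro t ht
  have h1 : IsClosed (s ∩ (fun z => g (χ z)) ⁻¹' t) :=
    hg.preimage_isClosed_of_isClosed hs.isClosed ht
  have h2 : IsCompact (s ∩ (fun z => g (χ z)) ⁻¹' t) := hs.of_isClosed_subset h1 inter_subset_left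
  refine ⟨χ '' (s ∩ (fun z => g (χ z)) ⁻¹' t),
    (h2.image_of_continuousOn (hχ.mono inter_subset_left)).isClosed, ?_⟩
  ext x
  constructor
  · rintro ⟨hx, z, hz, rfl⟩
    exact ⟨⟨z, ⟨hz, hx⟩, rfl⟩, ⟨z, hz, rfl⟩⟩
  · rintro ⟨⟨z, ⟨hz, hx⟩, rfl⟩, -⟩
    exact ⟨hx, z, hz, rfl⟩

lemma continuousOn_finite_biUnion {ι X Y : Type*} [TopologicalSpace X] [TopologicalSpace Y]
    {I : Set ι} (hI : I.Finite) {A : ι → Set X} (hA : ∀ i ∈ I, IsClosed (A i)) {g : X → Y}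
    (hg : ∀ i ∈ I, ContinuousOn g (A i)) : ContinuousOn g (⋃ i ∈ I, A i) := by
  induction I, hI using Set.Finite.induction_on with
  | empty => simp
  | @insert a s _ hs ih =>
    rw [biUnion_insert]
    refine ContinuousOn.union_of_isClosed (hg a (mem_insert _ _))
      (ih (fun i hi => hA i (mem_insert_of_mem _ hi)) fun i hi => hg i (mem_insert_of_mem _ hi))
      (hA a (mem_insert _ _)) ?_
    exact hs.isClosed_biUnion fun i hi => hA i (mem_insert_of_mem _ hi)

lemma exists_radial {E : Type*} [NormedAddCommGroup E] [InnerProductSpace ℝ E] (w : E)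
    (hw : ‖w‖ < 1) : ∃ ρ : E → E, ContinuousOn ρ {w}ᶜ ∧ (∀ z, z ≠ w → ‖ρ z‖ = 1) ∧
      ∀ z, ‖z‖ = 1 → ρ z = z := by
  set q : E → ℝ := fun z => inner ℝ w (z - w) with hq
  set S : E → ℝ := fun z => √(q z ^ 2 + ‖z - w‖ ^ 2 * (1 - ‖w‖ ^ 2)) with hS
  set t : E → ℝ := fun z => (- q z + S z) / ‖z - w‖ ^ 2 with ht
  have hw2 : 0 < 1 - ‖w‖ ^ 2 := by nlinarith [norm_nonneg w]
  have hSS : ∀ z, S z ^ 2 = q z ^ 2 + ‖z - w‖ ^ 2 * (1 - ‖w‖ ^ 2) := fun z =>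
    Real.sq_sqrt (by positivity)
  have hexp : ∀ z, ∀ c : ℝ, ‖w + c • (z - w)‖ ^ 2
      = ‖w‖ ^ 2 + 2 * (c * q z) + c ^ 2 * ‖z - w‖ ^ 2 := by
    intro z c
    rw [norm_add_sq_real, inner_smul_right, norm_smul, mul_pow, Real.norm_eq_abs, sq_abs]
  refine ⟨fun z => w + t z • (z - w), ?_, ?_, ?_⟩
  · have hqc : Continuous q := by fun_prop
    have hSc : Continuous S := by fun_prop
    have : ContinuousOn t {w}ᶜ := by
      refine ContinuousOn.div (by fun_prop) (by fun_prop) fun z hz => ?_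
      have : z - w ≠ 0 := sub_ne_zero.2 hz
      positivity
    exact continuousOn_const.add (this.smul (by fun_prop))
  · intro z hz
    have hne : z - w ≠ 0 := sub_ne_zero.2 hz
    have hpos : 0 < ‖z - w‖ := norm_pos_iff.2 hne
    have h1 : ‖w + t z • (z - w)‖ ^ 2 = 1 := by
      rw [hexp]
      have hS2 := hSS z
      have htm : t z * ‖z - w‖ ^ 2 = - q z + S z := by
        simp only [ht]; field_simp
      have h3 : ‖z - w‖ ^ 2 * (‖w‖ ^ 2 + 2 * (t z * q z) + t z ^ 2 * ‖z - w‖ ^ 2 - 1) = 0 := by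
        have : ‖z - w‖ ^ 2 * (‖w‖ ^ 2 + 2 * (t z * q z) + t z ^ 2 * ‖z - w‖ ^ 2 - 1)
          = ‖z - w‖ ^ 2 * (‖w‖ ^ 2 - 1) + 2 * (t z * ‖z - w‖ ^ 2) * q z
            + (t z * ‖z - w‖ ^ 2) ^ 2 := by ring
        rw [this, htm]; linear_combination hS2
      rcases mul_eq_zero.1 h3 with h | h
      · exact absurd h (by positivity)
      · linarith
    nlinarith [norm_nonneg (w + t z • (z - w))]
  · intro z hz
    have hne : z - w ≠ 0 := by
      intro h; rw [sub_eq_zero.1 h] at hz; linarith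
    have hpos : 0 < ‖z - w‖ ^ 2 := by positivity
    have h1 := hexp z 1
    rw [one_smul, add_sub_cancel, hz] at h1
    have h2 : S z = ‖z - w‖ ^ 2 + q z := by
      have h3 : 0 ≤ ‖z - w‖ ^ 2 + q z := by
        have : ‖z - w‖ ^ 2 + q z = 1 - inner ℝ w z := by
          have h5 : q z = inner ℝ w z - ‖w‖ ^ 2 := by
            simp only [hq, inner_sub_right, real_inner_self_eq_norm_sq]
          linarith
        rw [this]
        have := real_inner_le_norm w z
        rw [hz] at this; linarith
      have h4 : q z ^ 2 + ‖z - w‖ ^ 2 * (1 - ‖w‖ ^ 2) = (‖z - w‖ ^ 2 + q z) ^ 2 := by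
        linear_combination ‖z - w‖ ^ 2 * h1
      simp only [hS]
      rw [h4, Real.sqrt_sq h3]
    have h6 : t z = 1 := by
      simp only [ht, h2]; rw [div_eq_one_iff_eq hpos.ne']; ring
    simp [h6]

/-- Radial extension of a path-valued map on the unit sphere. -/
noncomputable def coneExt {E Y : Type*} [NormedAddCommGroup E] [NormedSpace ℝ E]
    [TopologicalSpace Y] (a : E → C(unitInterval, Y)) (c : Y) (z : E) : Y :=
  open Classical in
  if z = 0 then c else a (‖z‖⁻¹ • z) (projIcc 0 1 zero_le_one ‖z‖)

lemma continuous_coneExt {E Y : Type*} [NormedAddCommGroup E] [NormedSpace ℝ E]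
    [TopologicalSpace Y] (a : E → C(unitInterval, Y)) (c : Y)
    (ha : ContinuousOn a (sphere 0 1))
    (hc : ∀ u ∈ sphere (0 : E) 1, ∀ r : unitInterval, (r : ℝ) ≤ 1 / 4 → a u r = c) :
    Continuous (coneExt a c) := by
  have hunit : ∀ z : E, z ≠ 0 → ‖z‖⁻¹ • z ∈ sphere (0 : E) 1 := fun z hz => by
    rw [mem_sphere_zero_iff_norm, norm_smul, norm_inv, norm_norm,
      inv_mul_cancel₀ (norm_ne_zero_iff.2 hz)]
  rw [continuous_iff_continuousAt]
  intro z
  rcases eq_or_ne z 0 with rfl | hz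
  · have : coneExt a c =ᶠ[𝓝 (0 : E)] fun _ => c := by
      filter_upwards [ball_mem_nhds (0 : E) (by norm_num : (0 : ℝ) < 1 / 4)] with z hz
      unfold coneExt
      split_ifs with h
      · rfl
      · refine hc _ (hunit z h) _ ?_
        rw [mem_ball_zero_iff] at hz
        rw [coe_projIcc]
        refine max_le (by norm_num) ((min_le_right _ _).trans hz.le)
    exact (continuousAt_const).congr this.symm
  · have h1 : coneExt a c =ᶠ[𝓝 z] fun z => a (‖z‖⁻¹ • z) (projIcc 0 1 zero_le_one ‖z‖) := by
      filter_upwards [isOpen_ne.mem_nhds hz] with y hy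
      simp [coneExt, hy]
    refine ContinuousAt.congr ?_ h1.symm
    have h2 : ContinuousOn (fun z : E => ‖z‖⁻¹ • z) {z | z ≠ 0} :=
      (continuousOn_id.norm.inv₀ fun z hz => norm_ne_zero_iff.2 hz).smul continuousOn_id
    have h3 : ContinuousOn (fun z : E => a (‖z‖⁻¹ • z)) {z | z ≠ 0} := ha.comp h2 hunit
    have h4 := h3.continuousAt (isOpen_ne.mem_nhds hz)
    have h5 : Continuous fun z : E => projIcc (0 : ℝ) 1 zero_le_one ‖z‖ :=
      continuous_projIcc.comp continuous_norm
    exact h4.eval h5.continuousAt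

lemma coneExt_sphere {E Y : Type*} [NormedAddCommGroup E] [NormedSpace ℝ E]
    [TopologicalSpace Y] (a : E → C(unitInterval, Y)) (c : Y) (z : E) (hz : ‖z‖ = 1) :
    coneExt a c z = a z 1 := by
  have : z ≠ 0 := by rintro rfl; simp at hz
  simp only [coneExt, this, if_false, hz, inv_one, one_smul]
  congr 1
  exact projIcc_right (h := zero_le_one)

lemma coneExt_cases {E Y : Type*} [NormedAddCommGroup E] [NormedSpace ℝ E]
    [TopologicalSpace Y] (a : E → C(unitInterval, Y)) (c : Y) (z : E) :
    coneExt a c z = c ∨ ∃ u ∈ sphere (0 : E) 1, ∃ r, coneExt a c z = a u r := by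
  unfold coneExt
  split_ifs with h
  · exact Or.inl rfl
  · refine Or.inr ⟨_, ?_, _, rfl⟩
    rw [mem_sphere_zero_iff_norm, norm_smul, norm_inv, norm_norm,
      inv_mul_cancel₀ (norm_ne_zero_iff.2 h)]

lemma exists_bump {E V : Type*} [NormedAddCommGroup E] [NormedSpace ℝ E]
    [NormedAddCommGroup V] [NormedSpace ℝ V] (y : E → V) (hy : ContinuousOn y (ball 0 1))
    (hy1 : ∀ z ∈ ball (0 : E) 1, ‖y z‖ = 1) (hinj : InjOn y (ball 0 1)) (z₀ : E)
    (hz₀ : ‖z₀‖ = 1 / 2) (ε : ℝ) (hε : 0 < ε) (hε1 : ε ≤ 1 / 8) :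
    ∃ e : E → V, Continuous e ∧ (∀ z, e z ≠ 0) ∧ (∀ z, ε ≤ ‖z - z₀‖ → e z = - y z₀) ∧
      ∀ z ∈ ball (0 : E) 1, ∀ c : ℝ, 0 < c → e z ≠ -(c • y z) := by
  have hz₀b : z₀ ∈ ball (0 : E) 1 := by rw [mem_ball_zero_iff, hz₀]; norm_num
  set u : E → ℝ := fun z => max 0 (1 - ‖z - z₀‖ / ε) with hu
  have huc : Continuous u := by fun_prop
  have hu0 : ∀ z, 0 ≤ u z := fun z => le_max_left _ _
  have hu1 : ∀ z, u z ≤ 1 := fun z => max_le zero_le_one (by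
    have : 0 ≤ ‖z - z₀‖ / ε := by positivity
    linarith)
  have huz : ∀ z, ε ≤ ‖z - z₀‖ → u z = 0 := fun z hz => by
    have : 1 ≤ ‖z - z₀‖ / ε := (one_le_div hε).2 hz
    simp only [hu]; exact max_eq_left (by linarith)
  have hu00 : u z₀ = 1 := by simp [hu]
  have hs0 := hy1 z₀ hz₀b
  have hnear : ∀ z, ‖z - z₀‖ < ε → z ∈ ball (0 : E) 1 := fun z hz => by
    rw [mem_ball_zero_iff]
    have : ‖z‖ ≤ ‖z - z₀‖ + ‖z₀‖ := by simpa using norm_add_le (z - z₀) z₀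
    linarith
  -- key: positive multiples
  have key : ∀ z ∈ ball (0 : E) 1, ∀ p q : ℝ, 0 ≤ p → 0 ≤ q → p + q ≠ 0 → p • y z = q • y z₀ →
      z = z₀ ∧ p = q := by
    intro z hz p q hp hq hpq h
    have h1 := congrArg norm h
    rw [norm_smul, norm_smul, hy1 z hz, hs0, Real.norm_of_nonneg hp, Real.norm_of_nonneg hq,
      mul_one, mul_one] at h1
    subst h1
    have hp0 : p ≠ 0 := by intro h; apply hpq; linarith
    exact ⟨hinj hz hz₀b (smul_right_injective V hp0 h), rfl⟩
  set e : E → V := fun z => u z • y z - (1 - u z) • y z₀ with he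
  have hfar : ∀ z, ε ≤ ‖z - z₀‖ → e z = - y z₀ := fun z hz => by simp [he, huz z hz]
  refine ⟨e, ?_, ?_, hfar, ?_⟩
  · rw [continuous_iff_continuousAt]
    intro z
    by_cases hz : z ∈ ball (0 : E) 1
    · have : ContinuousOn e (ball 0 1) :=
        (huc.continuousOn.smul hy).sub
          ((continuousOn_const.sub huc.continuousOn).smul continuousOn_const)
      exact this.continuousAt (isOpen_ball.mem_nhds hz)
    · have h1 : ε < ‖z - z₀‖ := by
        rw [mem_ball_zero_iff, not_lt] at hz
        have : ‖z‖ ≤ ‖z - z₀‖ + ‖z₀‖ := by simpa using norm_add_le (z - z₀) z₀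
        linarith
      have h2 : e =ᶠ[𝓝 z] fun _ => - y z₀ := by
        have ho : IsOpen {z : E | ε < ‖z - z₀‖} := isOpen_lt continuous_const (by fun_prop)
        filter_upwards [ho.mem_nhds h1] with x hx using hfar x (le_of_lt hx)
      exact continuousAt_const.congr h2.symm
  · intro z h0
    by_cases hz : ε ≤ ‖z - z₀‖
    · rw [hfar z hz, neg_eq_zero] at h0
      rw [h0, norm_zero] at hs0; norm_num at hs0
    · have hzb := hnear z (not_le.1 hz)
      obtain ⟨h1, h2⟩ := key z hzb (u z) (1 - u z) (hu0 z) (by linarith [hu1 z]) (by norm_num)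
        (sub_eq_zero.1 h0)
      rw [h1, hu00] at h2; norm_num at h2
  · intro z hz c hc h0
    have h1 : (u z + c) • y z = (1 - u z) • y z₀ := by
      simp only [he] at h0
      rw [add_smul, ← sub_eq_zero]
      rw [eq_neg_iff_add_eq_zero] at h0
      rw [← h0]; abel
    obtain ⟨h2, h3⟩ := key z hz (u z + c) (1 - u z) (by linarith [hu0 z]) (by linarith [hu1 z])
      (by linarith) h1
    rw [h2, hu00] at h3; linarith
end Prelim

namespace CWComplexCells
section Cells
open Filter Topology
variable {X : Type} [TopologicalSpace X] [T2Space X] (K : CWComplexCells X)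

lemma cell_unique {i j : K.Cell} {x : X} (hi : x ∈ K.cellSet i) (hj : x ∈ K.cellSet j) :
    i = j := by
  by_contra h
  exact Set.disjoint_left.1 (K.cells_disjoint i j h) hi hj

lemma exists_cell (x : X) : ∃ i, x ∈ K.cellSet i := by
  have : x ∈ ⋃ τ : K.Cell, K.charMap τ '' ball 0 1 := by rw [K.cells_cover]; trivial
  exact mem_iUnion.1 this

lemma isCompact_closedCell (i : K.Cell) : IsCompact (K.charMap i '' closedBall 0 1) :=
  (isCompact_closedBall _ _).image_of_continuousOn (K.charMap_continuousOn i)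

lemma isClosed_closedCell (i : K.Cell) : IsClosed (K.charMap i '' closedBall 0 1) :=
  (K.isCompact_closedCell i).isClosed

lemma cellSet_subset_closedCell (i : K.Cell) : K.cellSet i ⊆ K.charMap i '' closedBall 0 1 :=
  image_mono ball_subset_closedBall

lemma sphere_cell (i : K.Cell) {z : EuclideanSpace ℝ (Fin (K.dim i))} (hz : ‖z‖ = 1) :
    ∃ j, K.dim j < K.dim i ∧ K.charMap i z ∈ K.cellSet j := by
  obtain ⟨I, -, hI, hs⟩ := K.sphere_subset i
  have : K.charMap i z ∈ ⋃ σ ∈ I, K.charMap σ '' ball 0 1 := hs ⟨z, by simpa using hz, rfl⟩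
  simp only [mem_iUnion] at this
  obtain ⟨j, hj, hx⟩ := this
  exact ⟨j, hI j hj, hx⟩

lemma ball_or_sphere {k : ℕ} {z : EuclideanSpace ℝ (Fin k)} (hz : z ∈ closedBall (0 : EuclideanSpace ℝ (Fin k)) 1) :
    z ∈ ball (0 : EuclideanSpace ℝ (Fin k)) 1 ∨ ‖z‖ = 1 := by
  rw [mem_closedBall_zero_iff] at hz
  rw [mem_ball_zero_iff]
  exact hz.lt_or_eq

lemma mem_ball_of_mem_cellSet {i : K.Cell} {z : EuclideanSpace ℝ (Fin (K.dim i))}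
    (hz : z ∈ closedBall (0 : EuclideanSpace ℝ (Fin (K.dim i))) 1)
    (h : K.charMap i z ∈ K.cellSet i) : z ∈ ball (0 : EuclideanSpace ℝ (Fin (K.dim i))) 1 := by
  rcases ball_or_sphere hz with h1 | h1
  · exact h1
  · obtain ⟨j, hj, hx⟩ := K.sphere_cell i h1
    have := K.cell_unique h hx
    subst this
    exact absurd hj (lt_irrefl _)

lemma not_mem_cellSet_of_closedCell {i ν : K.Cell} (hd : K.dim i ≤ K.dim ν) (hne : i ≠ ν) {x : X}
    (hx : x ∈ K.charMap i '' closedBall 0 1) : x ∉ K.cellSet ν := by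
  rintro hν
  obtain ⟨z, hz, rfl⟩ := hx
  rcases ball_or_sphere hz with h1 | h1
  · exact hne (K.cell_unique ⟨z, h1, rfl⟩ hν)
  · obtain ⟨j, hj, hx⟩ := K.sphere_cell i h1
    have := K.cell_unique hν hx
    subst this
    omega

/-- The map on `X` given by `g` on the open cell `ν` and constant elsewhere. -/
noncomputable def extBy {Y : Type} (ν : K.Cell) (g : EuclideanSpace ℝ (Fin (K.dim ν)) → Y) (c : Y)
    (x : X) : Y :=
  open Classical in
  if h : x ∈ K.cellSet ν then g h.choose else c

lemma extBy_not_mem {Y : Type} {ν : K.Cell} (g : EuclideanSpace ℝ (Fin (K.dim ν)) → Y) (c : Y)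
    {x : X} (hx : x ∉ K.cellSet ν) : K.extBy ν g c x = c := by
  simp [extBy, hx]

lemma extBy_ball {Y : Type} {ν : K.Cell} (g : EuclideanSpace ℝ (Fin (K.dim ν)) → Y) (c : Y)
    {w : EuclideanSpace ℝ (Fin (K.dim ν))} (hw : w ∈ ball (0 : EuclideanSpace ℝ (Fin (K.dim ν))) 1) :
    K.extBy ν g c (K.charMap ν w) = g w := by
  have h : K.charMap ν w ∈ K.cellSet ν := ⟨w, hw, rfl⟩
  have h2 := h.choose_spec
  simp only [extBy, h, dif_pos]
  rw [K.charMap_injOn ν h2.1 hw h2.2]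

lemma extBy_closedBall {Y : Type} {ν : K.Cell} (g : EuclideanSpace ℝ (Fin (K.dim ν)) → Y) (c : Y)
    (hg : ∀ w, ‖w‖ = 1 → g w = c) {w : EuclideanSpace ℝ (Fin (K.dim ν))}
    (hw : w ∈ closedBall (0 : EuclideanSpace ℝ (Fin (K.dim ν))) 1) :
    K.extBy ν g c (K.charMap ν w) = g w := by
  rcases ball_or_sphere hw with h1 | h1
  · exact K.extBy_ball g c h1
  · rw [hg w h1, extBy_not_mem]
    intro h
    have := K.mem_ball_of_mem_cellSet hw h
    rw [mem_ball_zero_iff] at this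
    linarith

lemma extBy_cases {Y : Type} {ν : K.Cell} (g : EuclideanSpace ℝ (Fin (K.dim ν)) → Y) (c : Y)
    (x : X) : K.extBy ν g c x ∈ insert c (range g) := by
  unfold extBy
  split_ifs
  · exact Or.inr ⟨_, rfl⟩
  · exact Or.inl rfl

lemma continuousOn_extBy {Y : Type} [TopologicalSpace Y] {ν : K.Cell}
    (g : EuclideanSpace ℝ (Fin (K.dim ν)) → Y) (c : Y) (hgc : ContinuousOn g (closedBall 0 1))
    (hg : ∀ w, ‖w‖ = 1 → g w = c) {i : K.Cell} (hi : K.dim i ≤ K.dim ν) :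
    ContinuousOn (K.extBy ν g c) (K.charMap i '' closedBall 0 1) := by
  rcases eq_or_ne i ν with rfl | hne
  · refine continuousOn_image_of_comp (isCompact_closedBall _ _) (K.charMap_continuousOn i) ?_
    exact hgc.congr fun w hw => K.extBy_closedBall g c hg hw
  · refine (continuousOn_const (c := c)).congr fun x hx => ?_
    exact K.extBy_not_mem g c (K.not_mem_cellSet_of_closedCell hi hne hx)

lemma continuousOn_extBy_sphere {Y : Type} [TopologicalSpace Y] {ν : K.Cell}
    (g : EuclideanSpace ℝ (Fin (K.dim ν)) → Y) (c : Y) (hgc : ContinuousOn g (closedBall 0 1))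
    (hg : ∀ w, ‖w‖ = 1 → g w = c) {j : K.Cell} (hj : K.dim j ≤ K.dim ν + 1) :
    ContinuousOn (fun z => K.extBy ν g c (K.charMap j z)) (sphere 0 1) := by
  obtain ⟨I, hIf, hI, hs⟩ := K.sphere_subset j
  have h1 : ContinuousOn (K.extBy ν g c) (⋃ i ∈ I, K.charMap i '' closedBall 0 1) :=
    continuousOn_finite_biUnion hIf (fun i _ => K.isClosed_closedCell i) fun i hi =>
      K.continuousOn_extBy g c hgc hg (by have := hI i hi; omega)
  refine h1.comp ((K.charMap_continuousOn j).mono sphere_subset_closedBall) fun z hz => ?_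
  have h2 := hs ⟨z, hz, rfl⟩
  simp only [mem_iUnion] at h2 ⊢
  obtain ⟨i, hi, hx⟩ := h2
  exact ⟨i, hi, K.cellSet_subset_closedCell i hx⟩

lemma exists_fill {Y : Type} [TopologicalSpace Y] {ν : K.Cell}
    (h : EuclideanSpace ℝ (Fin (K.dim ν)) → Y) (c : Y) (hh : Continuous h)
    (hc : ∀ w, 1 / 2 ≤ ‖w‖ → h w = c) {j : K.Cell} (hj : K.dim j ≤ K.dim ν + 1) (P : Set X)
    (hyp : (∃ w ∈ ball (0 : EuclideanSpace ℝ (Fin (K.dim j))) 1, K.charMap j w ∉ P) ∨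
      ∃ w ∈ ball (0 : EuclideanSpace ℝ (Fin (K.dim ν))) 1,
        K.charMap ν w ∉ K.charMap j '' closedBall 0 1) :
    ∃ B : EuclideanSpace ℝ (Fin (K.dim j)) → Y,
      ContinuousOn B (closedBall 0 1 ∩ K.charMap j ⁻¹' P) ∧
      (∀ z, ‖z‖ = 1 → B z = K.extBy ν h c (K.charMap j z)) ∧
      ∀ z, B z ∈ insert c (range h) := by
  rcases hyp with ⟨w, hw, hwP⟩ | ⟨p, hp, hpj⟩
  · rw [mem_ball_zero_iff] at hw
    obtain ⟨ρ, hρc, hρ1, hρid⟩ := exists_radial w hw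
    refine ⟨fun z => K.extBy ν h c (K.charMap j (ρ z)), ?_, ?_, fun z => K.extBy_cases h c _⟩
    · have h1 := K.continuousOn_extBy_sphere h c hh.continuousOn
        (fun w hw => hc w (by rw [hw]; norm_num)) hj
      refine h1.comp (hρc.mono ?_) ?_
      · rintro z ⟨-, hz⟩ rfl
        exact hwP hz
      · rintro z ⟨-, hz⟩
        rw [mem_sphere_zero_iff_norm]
        refine hρ1 z ?_
        rintro rfl
        exact hwP hz
    · intro z hz
      simp only [hρid z hz]
  · have hcl : IsClosed (closedBall 0 1 ∩ K.charMap ν ⁻¹' (K.charMap j '' closedBall 0 1)) :=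
      (K.charMap_continuousOn ν).preimage_isClosed_of_isClosed isClosed_closedBall
        (K.isClosed_closedCell j)
    obtain ⟨δ, hδ, hδb⟩ := Metric.isOpen_iff.1 hcl.isOpen_compl p (fun hx => hpj hx.2)
    have hfar : ∀ w ∈ ball (0 : EuclideanSpace ℝ (Fin (K.dim ν))) 1,
        K.charMap ν w ∈ K.charMap j '' closedBall 0 1 → δ ≤ ‖w - p‖ := by
      intro w hw hwj
      by_contra hlt
      exact hδb (show w ∈ ball p δ by rw [mem_ball, dist_eq_norm]; exact not_le.1 hlt)
        ⟨ball_subset_closedBall hw, hwj⟩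
    rw [mem_ball_zero_iff] at hp
    let G : C(EuclideanSpace ℝ (Fin (K.dim ν)) × unitInterval, Y) :=
      ⟨fun q => h (p + (1 + (1 - (q.2 : ℝ)) * (4 / δ)) • (q.1 - p)), hh.comp (by fun_prop)⟩
    let g : EuclideanSpace ℝ (Fin (K.dim ν)) → C(unitInterval, Y) := G.curry
    have hgap : ∀ w r, g w r = h (p + (1 + (1 - (r : ℝ)) * (4 / δ)) • (w - p)) := fun w r => rfl
    have hgc : Continuous g := G.curry.continuous
    have hg1 : ∀ w, ‖w‖ = 1 → g w = ContinuousMap.const _ c := by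
      intro w hw
      ext r
      rw [hgap, ContinuousMap.const_apply]
      refine hc _ ?_
      set s : ℝ := (1 - (r : ℝ)) * (4 / δ) with hs
      have hs0 : 0 ≤ s := mul_nonneg (by linarith [r.2.2]) (by positivity)
      have h1 : p + (1 + s) • (w - p) = (1 + s) • w - s • p := by
        rw [smul_sub, add_smul 1 s p, one_smul]; abel
      rw [h1]
      have h2 := norm_sub_norm_le ((1 + s) • w) (s • p)
      rw [norm_smul, norm_smul, hw, Real.norm_of_nonneg hs0,
        Real.norm_of_nonneg (by linarith : 0 ≤ 1 + s)] at h2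
      nlinarith
    set a : EuclideanSpace ℝ (Fin (K.dim j)) → C(unitInterval, Y) :=
      fun z => K.extBy ν g (ContinuousMap.const _ c) (K.charMap j z) with ha
    have hac : ContinuousOn a (sphere 0 1) :=
      K.continuousOn_extBy_sphere g _ hgc.continuousOn hg1 hj
    refine ⟨coneExt a c, (continuous_coneExt a c hac ?_).continuousOn, ?_, ?_⟩
    · intro u hu r hr
      simp only [ha]
      by_cases hm : K.charMap j u ∈ K.cellSet ν
      · obtain ⟨w, hw, hwu⟩ := hm
        rw [← hwu, K.extBy_ball _ _ hw, hgap]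
        refine hc _ ?_
        have h1 := hfar w hw (by rw [hwu]; exact ⟨u, sphere_subset_closedBall hu, rfl⟩)
        set s : ℝ := 1 + (1 - (r : ℝ)) * (4 / δ) with hs
        have h4 : 0 < 4 / δ := by positivity
        have hs3 : 3 / δ ≤ s := by
          have : 3 / δ = 3 / 4 * (4 / δ) := by ring
          rw [this, hs]; nlinarith
        have h5 : 3 ≤ s * ‖w - p‖ := by
          have h6 : 3 / δ * δ = 3 := by field_simp
          have h7 : 0 < 3 / δ := by positivity
          calc (3 : ℝ) = 3 / δ * δ := h6.symm
            _ ≤ s * ‖w - p‖ := mul_le_mul hs3 h1 hδ.le (h7.le.trans hs3)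
        have h2 : ‖s • (w - p)‖ ≤ ‖p + s • (w - p)‖ + ‖p‖ := by
          have := norm_sub_le (p + s • (w - p)) p
          rwa [add_sub_cancel_left] at this
        rw [norm_smul] at h2
        have h8 : s ≤ ‖s‖ := Real.le_norm_self s
        nlinarith [norm_nonneg (w - p)]
      · rw [K.extBy_not_mem _ _ hm]; rfl
    · intro z hz
      rw [coneExt_sphere a c z hz]
      simp only [ha]
      by_cases hm : K.charMap j z ∈ K.cellSet ν
      · obtain ⟨w, hw, hwu⟩ := hm
        rw [← hwu, K.extBy_ball _ _ hw, K.extBy_ball _ _ hw, hgap]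
        simp
      · rw [K.extBy_not_mem _ _ hm, K.extBy_not_mem _ _ hm]; rfl
    · intro z
      rcases coneExt_cases a c z with h1 | ⟨u, -, r, h1⟩
      · exact Or.inl h1
      · rw [h1]
        simp only [ha]
        rcases K.extBy_cases g (ContinuousMap.const _ c) (K.charMap j u) with h2 | ⟨w, h2⟩
        · rw [h2]; exact Or.inl rfl
        · rw [← h2, hgap]; exact Or.inr ⟨_, rfl⟩

/-- Gluing maps defined on cells. -/
lemma exists_glue {Y : Type} [TopologicalSpace Y] (m : ℕ) (b : X → Y) (P : Set X)
    (hP : IsClosed P) {I : Set K.Cell} (hIf : I.Finite) (hIm : ∀ i ∈ I, K.dim i ≤ m)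
    (hPI : P ⊆ ⋃ i ∈ I, K.charMap i '' ball 0 1)
    (Bf : (i : K.Cell) → EuclideanSpace ℝ (Fin (K.dim i)) → Y)
    (hBc : ∀ i, K.dim i ≤ m → ContinuousOn (Bf i) (closedBall 0 1 ∩ K.charMap i ⁻¹' P))
    (hBs : ∀ i, K.dim i ≤ m → ∀ z, ‖z‖ = 1 → Bf i z = b (K.charMap i z))
    (hBl : ∀ i, K.dim i < m → ∀ z ∈ ball (0 : EuclideanSpace ℝ (Fin (K.dim i))) 1,
      Bf i z = b (K.charMap i z)) :
    ∃ B : X → Y, ContinuousOn B P ∧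
      ∀ i, ∀ z ∈ ball (0 : EuclideanSpace ℝ (Fin (K.dim i))) 1, B (K.charMap i z) = Bf i z := by
  choose ci hci using K.exists_cell
  choose cz hcz hcx using hci
  set B : X → Y := fun x => Bf (ci x) (cz x) with hB
  have hBi : ∀ i, ∀ z ∈ ball (0 : EuclideanSpace ℝ (Fin (K.dim i))) 1,
      B (K.charMap i z) = Bf i z := by
    intro i z hz
    simp only [hB]
    have h1 := hcx (K.charMap i z)
    have h2 := hcz (K.charMap i z)
    generalize cz (K.charMap i z) = z' at h1 h2 ⊢
    have h3 : ci (K.charMap i z) = i := by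
      refine K.cell_unique (x := K.charMap i z) ⟨z', h2, h1⟩ ⟨z, hz, rfl⟩
    generalize ci (K.charMap i z) = i' at z' h1 h2 h3 ⊢
    subst h3
    rw [K.charMap_injOn _ h2 hz h1]
  refine ⟨B, ?_, hBi⟩
  have hcov : P ⊆ ⋃ i ∈ I, K.charMap i '' (closedBall 0 1 ∩ K.charMap i ⁻¹' P) := by
    intro x hx
    have := hPI hx
    simp only [mem_iUnion] at this ⊢
    obtain ⟨i, hi, z, hz, rfl⟩ := this
    exact ⟨i, hi, z, ⟨ball_subset_closedBall hz, hx⟩, rfl⟩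
  have hcl : ∀ i, IsCompact (closedBall 0 1 ∩ K.charMap i ⁻¹' P) := fun i =>
    (isCompact_closedBall _ _).of_isClosed_subset
      ((K.charMap_continuousOn i).preimage_isClosed_of_isClosed isClosed_closedBall hP)
      inter_subset_left
  have hci : ∀ i, ContinuousOn (K.charMap i) (closedBall 0 1 ∩ K.charMap i ⁻¹' P) := fun i =>
    (K.charMap_continuousOn i).mono inter_subset_left
  refine ContinuousOn.mono (continuousOn_finite_biUnion hIf
    (fun i _ => ((hcl i).image_of_continuousOn (hci i)).isClosed) fun i hi => ?_) hcov
  refine continuousOn_image_of_comp (hcl i) (hci i) ((hBc i (hIm i hi)).congr ?_)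
  rintro z ⟨hz, -⟩
  rcases ball_or_sphere hz with h1 | h1
  · exact hBi i z h1
  · obtain ⟨i', hi', z', hz', hzz⟩ := K.sphere_cell i h1
    have := hIm i hi
    show B (K.charMap i z) = _
    rw [hBs i this z h1, ← hzz, hBi i' z' hz', hBl i' (by omega) z' hz']
end Cells
end CWComplexCells

namespace CWComplexCells
section Core
open Filter Topology
variable {X : Type} [TopologicalSpace X] [T2Space X] (K : CWComplexCells X)

lemma preim_norm {ν σ : K.Cell} (hne : ν ≠ σ) {z : EuclideanSpace ℝ (Fin (K.dim σ))}
    (hz : z ∈ K.preim ν σ) : ‖z‖ = 1 := by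
  rcases ball_or_sphere hz.1 with h | h
  · exact absurd (K.cell_unique hz.2 ⟨z, h, rfl⟩) hne
  · exact h

/-- The section of a regular face. -/
lemma exists_section {ν σ : K.Cell} (hne : ν ≠ σ) (hr : K.RegularFace ν σ) :
    ∃ y : EuclideanSpace ℝ (Fin (K.dim ν)) → EuclideanSpace ℝ (Fin (K.dim σ)),
      ContinuousOn y (ball 0 1) ∧ (∀ w ∈ ball (0 : EuclideanSpace ℝ (Fin (K.dim ν))) 1,
        ‖y w‖ = 1 ∧ K.charMap σ (y w) = K.charMap ν w) ∧
      ∀ w ∈ ball (0 : EuclideanSpace ℝ (Fin (K.dim ν))) 1,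
        ∀ z ∈ closedBall (0 : EuclideanSpace ℝ (Fin (K.dim σ))) 1,
        K.charMap σ z = K.charMap ν w → z = y w := by
  classical
  obtain ⟨-, ⟨e, he⟩, -⟩ := hr
  let g : ball (0 : EuclideanSpace ℝ (Fin (K.dim ν))) 1 → K.cellSet ν :=
    fun w => ⟨K.charMap ν w, w, w.2, rfl⟩
  have hg : Continuous g := Continuous.subtype_mk
    (((K.charMap_continuousOn ν).mono ball_subset_closedBall).domRestrict) _
  set y : EuclideanSpace ℝ (Fin (K.dim ν)) → EuclideanSpace ℝ (Fin (K.dim σ)) := fun w =>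
    if h : w ∈ ball (0 : EuclideanSpace ℝ (Fin (K.dim ν))) 1 then (e.symm (g ⟨w, h⟩) : _) else 0
    with hy
  have hyw : ∀ w, ∀ h : w ∈ ball (0 : EuclideanSpace ℝ (Fin (K.dim ν))) 1,
      y w = e.symm (g ⟨w, h⟩) := fun w h => by simp only [hy, h, dif_pos]
  have hye : ∀ w ∈ ball (0 : EuclideanSpace ℝ (Fin (K.dim ν))) 1,
      K.charMap σ (y w) = K.charMap ν w := by
    intro w h
    rw [hyw w h, ← he, Homeomorph.apply_symm_apply]
  refine ⟨y, ?_, fun w h => ⟨?_, hye w h⟩, fun w h z hz hzw => ?_⟩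
  · rw [continuousOn_iff_continuous_domRestrict]
    have : (ball (0 : EuclideanSpace ℝ (Fin (K.dim ν))) 1).domRestrict y
        = fun w => (e.symm (g w) : EuclideanSpace ℝ (Fin (K.dim σ))) := by
      funext w; exact hyw w w.2
    rw [this]
    exact continuous_subtype_val.comp (e.symm.continuous.comp hg)
  · rw [hyw w h]
    exact K.preim_norm hne (e.symm (g ⟨w, h⟩)).2
  · have hzm : z ∈ K.preim ν σ := ⟨hz, by rw [mem_preimage, hzw]; exact ⟨w, h, rfl⟩⟩
    rw [hyw w h]
    have : e ⟨z, hzm⟩ = g ⟨w, h⟩ := Subtype.ext (by rw [he]; exact hzw)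
    rw [← this, Homeomorph.symm_apply_apply]

lemma exists_eps {ν σ : K.Cell} (hd : K.dim ν + 1 = K.dim σ)
    {m₀ : EuclideanSpace ℝ (Fin (K.dim σ))} (hm₀ : ‖m₀‖ = 1)
    (hm : K.charMap σ m₀ = K.charMap ν 0) :
    ∃ ε : ℝ, 0 < ε ∧ ε ≤ 1 / 8 ∧ ∀ z, ‖z‖ = 1 → ‖z - m₀‖ < 4 * ε →
      ∃ w, ‖w‖ < 1 / 2 ∧ K.charMap σ z = K.charMap ν w := by
  obtain ⟨I, hIf, hI, hs⟩ := K.sphere_subset σ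
  set Z : Set X := K.charMap ν '' (closedBall 0 1 \ ball 0 (1 / 2)) ∪
    ⋃ i ∈ I \ {ν}, K.charMap i '' closedBall 0 1 with hZ
  have hZc : IsClosed Z := by
    refine IsClosed.union ?_ ?_
    · exact (((isCompact_closedBall _ _).diff isOpen_ball).image_of_continuousOn
        ((K.charMap_continuousOn ν).mono sdiff_subset)).isClosed
    · exact (hIf.subset sdiff_subset).isClosed_biUnion fun i _ => K.isClosed_closedCell i
  have h0 : (0 : EuclideanSpace ℝ (Fin (K.dim ν))) ∈ ball (0 : EuclideanSpace ℝ (Fin (K.dim ν))) 1 :=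
    mem_ball_self one_pos
  have hmZ : K.charMap σ m₀ ∉ Z := by
    rw [hm]
    rintro (⟨w, ⟨hw, hw2⟩, hw0⟩ | h)
    · have h1 := K.mem_ball_of_mem_cellSet hw (by rw [hw0]; exact ⟨0, h0, rfl⟩)
      have := K.charMap_injOn ν h1 h0 hw0
      subst this
      exact hw2 (mem_ball_self (by norm_num))
    · simp only [mem_iUnion] at h
      obtain ⟨i, hi, hx⟩ := h
      refine K.not_mem_cellSet_of_closedCell (ν := ν) ?_ hi.2 hx ⟨0, h0, rfl⟩
      have := hI i hi.1
      omega
  have hcl : IsClosed (closedBall 0 1 ∩ K.charMap σ ⁻¹' Z) :=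
    (K.charMap_continuousOn σ).preimage_isClosed_of_isClosed isClosed_closedBall hZc
  obtain ⟨δ, hδ, hδb⟩ := Metric.isOpen_iff.1 hcl.isOpen_compl m₀ (fun hx => hmZ hx.2)
  refine ⟨min (δ / 4) (1 / 8), by positivity, min_le_right _ _, fun z hz hzm => ?_⟩
  have h1 : ‖z - m₀‖ < δ := by
    have := min_le_left (δ / 4) (1 / 8)
    linarith
  have h2 : K.charMap σ z ∉ Z := fun h =>
    hδb (show z ∈ ball m₀ δ by rwa [mem_ball, dist_eq_norm])
      ⟨by rw [mem_closedBall_zero_iff]; exact hz.le, h⟩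
  have h3 := hs ⟨z, by simpa using hz, rfl⟩
  simp only [mem_iUnion] at h3
  obtain ⟨i, hi, w, hw, hwz⟩ := h3
  by_cases hiν : i = ν
  · subst hiν
    refine ⟨w, ?_, hwz.symm⟩
    by_contra hlt
    refine h2 (Or.inl ⟨w, ⟨ball_subset_closedBall hw, ?_⟩, hwz⟩)
    rwa [mem_ball_zero_iff]
  · exfalso
    refine h2 (Or.inr ?_)
    simp only [mem_iUnion]
    exact ⟨i, ⟨hi, hiν⟩, w, ball_subset_closedBall hw, hwz⟩

theorem core {ν σ τ : K.Cell} (hνσ : K.Facet ν σ) (hστ : K.Facet σ τ)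
    (r1 : K.RegularFace σ τ) (r2 : K.RegularFace ν σ)
    (hno : ∀ j, j ≠ σ → K.Facet ν j → ¬ K.Facet j τ) : False := by
  have hd1 := hνσ.2
  have hd2 := hστ.2
  have hne1 : ν ≠ σ := by rintro rfl; omega
  have hne2 : σ ≠ τ := by rintro rfl; omega
  obtain ⟨y, hyc, hyu, hyuniq⟩ := K.exists_section hne2 r1
  obtain ⟨μ, hμc, hμu, hμuniq⟩ := K.exists_section hne1 r2
  have hyinj : InjOn y (ball 0 1) := by
    intro z hz z' hz' h
    refine K.charMap_injOn σ hz hz' ?_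
    rw [← (hyu z hz).2, ← (hyu z' hz').2, h]
  have h0ν : (0 : EuclideanSpace ℝ (Fin (K.dim ν))) ∈
    ball (0 : EuclideanSpace ℝ (Fin (K.dim ν))) 1 := mem_ball_self one_pos
  set m₀ := μ 0 with hm₀def
  obtain ⟨hm₀, hm₀ν⟩ := hμu 0 h0ν
  obtain ⟨ε, hε, hε1, hεν⟩ := K.exists_eps hd1 hm₀ hm₀ν
  set z₀ : EuclideanSpace ℝ (Fin (K.dim σ)) := (1 / 2 : ℝ) • m₀ with hz₀def
  have hz₀ : ‖z₀‖ = 1 / 2 := by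
    rw [hz₀def, norm_smul, hm₀]; norm_num
  have hz₀b : z₀ ∈ ball (0 : EuclideanSpace ℝ (Fin (K.dim σ))) 1 := by
    rw [mem_ball_zero_iff, hz₀]; norm_num
  obtain ⟨e, hec, hene, hefar, hedir⟩ :=
    exists_bump y hyc (fun z hz => (hyu z hz).1) hyinj z₀ hz₀ ε hε hε1
  set s₀ := y z₀ with hs₀
  have hs₀1 : ‖s₀‖ = 1 := (hyu z₀ hz₀b).1
  have hs₀ne : -s₀ ≠ 0 := by
    intro h; rw [neg_eq_zero] at h; rw [h, norm_zero] at hs₀1; norm_num at hs₀1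
  let G : C(EuclideanSpace ℝ (Fin (K.dim σ)) × unitInterval, EuclideanSpace ℝ (Fin (K.dim τ))) :=
    ⟨fun q => e ((q.2 : ℝ) • q.1), hec.comp (by fun_prop)⟩
  let ê : EuclideanSpace ℝ (Fin (K.dim σ)) → C(unitInterval, EuclideanSpace ℝ (Fin (K.dim τ))) :=
    G.curry
  have hêc : Continuous ê := G.curry.continuous
  have hêap : ∀ z r, ê z r = e ((r : ℝ) • z) := fun z r => rfl
  let c₀ : C(unitInterval, EuclideanSpace ℝ (Fin (K.dim τ))) := ContinuousMap.const _ (-s₀)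
  have hc₀ap : ∀ r, c₀ r = -s₀ := fun r => rfl
  have hêsmall : ∀ z, ‖z‖ ≤ 1 → ∀ r : unitInterval, (r : ℝ) ≤ 1 / 4 → ê z r = -s₀ := by
    intro z hz r hr
    rw [hêap]
    refine hefar _ ?_
    have h1 : ‖(r : ℝ) • z‖ ≤ 1 / 4 := by
      rw [norm_smul, Real.norm_of_nonneg r.2.1]
      nlinarith [r.2.1, norm_nonneg z]
    have h2 := norm_sub_norm_le z₀ ((r : ℝ) • z)
    rw [norm_sub_rev] at h2
    linarith
  have hêone : ∀ z, ‖z‖ = 1 → ê z 1 = -s₀ := by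
    intro z hz
    rw [hêap]
    refine hefar _ ?_
    have h2 := norm_sub_norm_le (((1 : unitInterval) : ℝ) • z) z₀
    simp only [Set.Icc.coe_one, one_smul] at h2 ⊢
    linarith
  have hêfar : ∀ z, ‖z‖ = 1 → 4 * ε ≤ ‖z - m₀‖ → ê z = c₀ := by
    intro z hz hzm
    ext1 r
    rw [hêap, hc₀ap]
    refine hefar _ ?_
    by_contra hlt
    rw [not_le] at hlt
    have h1 : |(r : ℝ) - 1 / 2| < ε := by
      have := abs_norm_sub_norm_le ((r : ℝ) • z) z₀
      rw [norm_smul, hz, hz₀, Real.norm_of_nonneg r.2.1, mul_one] at this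
      linarith
    have h2 : (1 / 2 : ℝ) • (z - m₀) = ((r : ℝ) • z - z₀) - ((r : ℝ) - 1 / 2) • z := by
      rw [hz₀def, smul_sub, sub_smul]; abel
    have h3 := norm_sub_le ((r : ℝ) • z - z₀) (((r : ℝ) - 1 / 2) • z)
    rw [← h2, norm_smul, norm_smul, hz, mul_one, Real.norm_eq_abs, Real.norm_eq_abs] at h3
    rw [abs_of_pos (by norm_num : (0 : ℝ) < 1 / 2)] at h3
    linarith
  have hêν : ∀ z, ‖z‖ = 1 → ê z ≠ c₀ → ∃ w, ‖w‖ < 1 / 2 ∧ K.charMap σ z = K.charMap ν w := by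
    intro z hz hzc
    refine hεν z hz ?_
    by_contra h
    exact hzc (hêfar z hz (not_lt.1 h))
  -- the map on ν
  classical
  set h : EuclideanSpace ℝ (Fin (K.dim ν)) → C(unitInterval, EuclideanSpace ℝ (Fin (K.dim τ))) :=
    fun w => if w ∈ ball (0 : EuclideanSpace ℝ (Fin (K.dim ν))) 1 then ê (μ w) else c₀ with hhdef
  have hhb : ∀ w ∈ ball (0 : EuclideanSpace ℝ (Fin (K.dim ν))) 1, h w = ê (μ w) := fun w hw => by
    simp only [hhdef, hw, if_true]
  have hhc₀ : ∀ w, 1 / 2 ≤ ‖w‖ → h w = c₀ := by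
    intro w hw
    by_cases hwb : w ∈ ball (0 : EuclideanSpace ℝ (Fin (K.dim ν))) 1
    · rw [hhb w hwb]
      by_contra hne
      obtain ⟨w', hw', hww⟩ := hêν (μ w) (hμu w hwb).1 hne
      rw [(hμu w hwb).2] at hww
      have := K.charMap_injOn ν hwb (by rw [mem_ball_zero_iff]; linarith) hww
      subst this
      linarith
    · simp only [hhdef, hwb, if_false]
  have hhc : Continuous h := by
    rw [continuous_iff_continuousAt]
    intro w
    by_cases hwb : w ∈ ball (0 : EuclideanSpace ℝ (Fin (K.dim ν))) 1
    · have : ContinuousOn h (ball 0 1) :=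
        (hêc.comp_continuousOn hμc).congr hhb
      exact this.continuousAt (isOpen_ball.mem_nhds hwb)
    · have h1 : (1 / 2 : ℝ) < ‖w‖ := by
        rw [mem_ball_zero_iff, not_lt] at hwb; linarith
      have h2 : h =ᶠ[𝓝 w] fun _ => c₀ := by
        have ho : IsOpen {w : EuclideanSpace ℝ (Fin (K.dim ν)) | (1 / 2 : ℝ) < ‖w‖} :=
          isOpen_lt continuous_const continuous_norm
        filter_upwards [ho.mem_nhds h1] with x hx using hhc₀ x (le_of_lt hx)
      exact continuousAt_const.congr h2.symm
  have hhsph : ∀ w, ‖w‖ = 1 → h w = c₀ := fun w hw => hhc₀ w (by rw [hw]; norm_num)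
  set b : X → C(unitInterval, EuclideanSpace ℝ (Fin (K.dim τ))) := K.extBy ν h c₀ with hb
  have hbσ : ∀ z, ‖z‖ = 1 → ê z = b (K.charMap σ z) := by
    intro z hz
    by_cases hm : K.charMap σ z ∈ K.cellSet ν
    · obtain ⟨w, hw, hwz⟩ := hm
      rw [hb, ← hwz, K.extBy_ball _ _ hw, hhb w hw]
      rw [← hμuniq w hw z (by rw [mem_closedBall_zero_iff]; exact hz.le) hwz.symm]
    · rw [hb, K.extBy_not_mem _ _ hm]
      by_contra hne
      obtain ⟨w, hw, hwz⟩ := hêν z hz hne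
      exact hm ⟨w, by rw [mem_ball_zero_iff]; linarith, hwz.symm⟩
  -- good values
  set Good : Set (C(unitInterval, EuclideanSpace ℝ (Fin (K.dim τ)))) :=
    {γ | (∀ r, γ r ≠ 0) ∧ ∀ r : unitInterval, (r : ℝ) ≤ 1 / 4 → γ r = -s₀} with hGood
  have hc₀G : c₀ ∈ Good := ⟨fun r => hs₀ne, fun r _ => rfl⟩
  have hêG : ∀ z, ‖z‖ ≤ 1 → ê z ∈ Good := fun z hz => ⟨fun r => hene _, hêsmall z hz⟩
  have hins : ∀ γ ∈ insert c₀ (range h), γ ∈ Good ∧ γ 1 = -s₀ := by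
    rintro γ (rfl | ⟨w, rfl⟩)
    · exact ⟨hc₀G, rfl⟩
    · by_cases hwb : w ∈ ball (0 : EuclideanSpace ℝ (Fin (K.dim ν))) 1
      · rw [hhb w hwb]
        exact ⟨hêG _ (hμu w hwb).1.le, hêone _ (hμu w hwb).1⟩
      · simp only [hhdef, hwb, if_false]
        exact ⟨hc₀G, rfl⟩
  set P : Set X := K.charMap τ '' sphere 0 1 with hP
  have hPτ : P ⊆ closure (K.cellSet τ) := by
    rw [cellSet, K.closure_cell]
    exact image_mono sphere_subset_closedBall
  have hPc : IsClosed P := ((isCompact_sphere _ _).image_of_continuousOn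
    ((K.charMap_continuousOn τ).mono sphere_subset_closedBall)).isClosed
  -- families
  have hfam : ∀ i : K.Cell, ∃ Bi : EuclideanSpace ℝ (Fin (K.dim i)) →
      C(unitInterval, EuclideanSpace ℝ (Fin (K.dim τ))),
      (K.dim i ≤ K.dim σ → ContinuousOn Bi (closedBall 0 1 ∩ K.charMap i ⁻¹' P)) ∧
      (K.dim i ≤ K.dim σ → ∀ z, ‖z‖ = 1 → Bi z = b (K.charMap i z)) ∧
      (K.dim i < K.dim σ → ∀ z ∈ ball (0 : EuclideanSpace ℝ (Fin (K.dim i))) 1,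
        Bi z = b (K.charMap i z)) ∧
      (∀ z, ‖z‖ ≤ 1 → Bi z ∈ Good) ∧
      (i ≠ σ → ∀ z, Bi z 1 = -s₀) ∧
      (∀ hi : i = σ, ∀ z, Bi z = ê (hi ▸ z)) := by
    intro i
    by_cases hiσ : i = σ
    · subst hiσ
      exact ⟨ê, fun _ => hêc.continuousOn, fun _ => hbσ, fun hlt => absurd hlt (lt_irrefl _),
        hêG, fun hne => absurd rfl hne, fun _ _ => rfl⟩
    rcases lt_trichotomy (K.dim i) (K.dim σ) with hlt | heq | hgt
    · refine ⟨fun z => b (K.charMap i z), fun _ => ?_, fun _ _ _ => rfl, fun _ _ _ => rfl,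
        fun z _ => (hins _ (K.extBy_cases h c₀ _)).1, fun _ z => (hins _ (K.extBy_cases h c₀ _)).2,
        fun hi => absurd hi hiσ⟩
      have h1 : ContinuousOn b (K.charMap i '' closedBall 0 1) :=
        K.continuousOn_extBy h c₀ hhc.continuousOn hhsph (by omega)
      exact (h1.comp (K.charMap_continuousOn i) (mapsTo_image _ _)).mono inter_subset_left
    · have hiτ : i ≠ τ := by rintro rfl; omega
      have hiν : i ≠ ν := by rintro rfl; omega
      have hyp : (∃ w ∈ ball (0 : EuclideanSpace ℝ (Fin (K.dim i))) 1, K.charMap i w ∉ P) ∨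
          ∃ w ∈ ball (0 : EuclideanSpace ℝ (Fin (K.dim ν))) 1,
            K.charMap ν w ∉ K.charMap i '' closedBall 0 1 := by
        by_contra hcon
        push Not at hcon
        obtain ⟨hc1, hc2⟩ := hcon
        refine hno i hiσ ⟨?_, by omega⟩ ⟨?_, by omega⟩
        · rintro _ ⟨w, hw, rfl⟩
          refine ⟨?_, fun hx => hiν (K.cell_unique hx ⟨w, hw, rfl⟩)⟩
          rw [cellSet, K.closure_cell]
          exact hc2 w hw
        · rintro _ ⟨w, hw, rfl⟩
          exact ⟨hPτ (hc1 w hw), fun hx => hiτ (K.cell_unique ⟨w, hw, rfl⟩ hx)⟩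
      obtain ⟨Bi, hB1, hB2, hB3⟩ := K.exists_fill h c₀ hhc hhc₀ (j := i) (by omega) P hyp
      exact ⟨Bi, fun _ => hB1, fun _ => hB2, fun hlt => by omega, fun z _ => (hins _ (hB3 z)).1,
        fun _ z => (hins _ (hB3 z)).2, fun hi => absurd hi hiσ⟩
    · exact ⟨fun _ => c₀, fun hle => by omega, fun hle => by omega, fun hle => by omega,
        fun _ _ => hc₀G, fun _ _ => rfl, fun hi => absurd hi hiσ⟩
  choose Bf hBc hBs hBl hBG hB1 hBσ using hfam
  obtain ⟨I, hIf, hI, hIs⟩ := K.sphere_subset τ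
  obtain ⟨B, hBcont, hBeq⟩ := K.exists_glue (K.dim σ) b P hPc hIf
    (fun i hi => by have := hI i hi; omega) hIs Bf hBc hBs hBl
  set a : EuclideanSpace ℝ (Fin (K.dim τ)) → C(unitInterval, EuclideanSpace ℝ (Fin (K.dim τ))) :=
    fun u => B (K.charMap τ u) with ha
  have hac : ContinuousOn a (sphere 0 1) :=
    hBcont.comp ((K.charMap_continuousOn τ).mono sphere_subset_closedBall) (mapsTo_image _ _)
  have haG : ∀ u, a u ∈ Good := by
    intro u
    obtain ⟨i, z, hz, hzu⟩ := K.exists_cell (K.charMap τ u)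
    simp only [ha]
    rw [← hzu, hBeq i z hz]
    exact hBG i z (by rw [mem_ball_zero_iff] at hz; exact hz.le)
  refine brouwer_dir (coneExt a (-s₀))
    (continuous_coneExt a (-s₀) hac fun u _ r hr => (haG u).2 r hr).continuousOn ?_ ?_
  · intro x _
    rcases coneExt_cases a (-s₀) x with h1 | ⟨u, -, r, h1⟩
    · rw [h1]; exact hs₀ne
    · rw [h1]; exact (haG u).1 r
  · intro u hu c hc
    rw [coneExt_sphere a _ u hu]
    obtain ⟨i, z, hz, hzu⟩ := K.exists_cell (K.charMap τ u)
    simp only [ha]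
    rw [← hzu, hBeq i z hz]
    by_cases hiσ : i = σ
    · subst hiσ
      have h1 : u = y z := hyuniq z hz u (by rw [mem_closedBall_zero_iff]; exact hu.le) hzu.symm
      rw [hBσ i rfl z, hêap, h1]
      simpa using hedir z hz c hc
    · rw [hB1 i hiσ z]
      intro heq
      rw [neg_inj] at heq
      have h1 := congrArg norm heq
      rw [norm_smul, hu, hs₀1, mul_one, Real.norm_of_nonneg hc.le] at h1
      rw [← h1, one_smul] at heq
      have h2 : K.charMap τ u ∈ K.cellSet σ := by
        rw [← heq, (hyu z₀ hz₀b).2]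
        exact ⟨z₀, hz₀b, rfl⟩
      exact hiσ (K.cell_unique ⟨z, hz, hzu⟩ h2)
end Core
end CWComplexCells

namespace CWComplexCells
section Collections
variable {X : Type} [TopologicalSpace X] [T2Space X] (K : CWComplexCells X)

lemma RPath.val {f : K.Cell → ℝ} {r : ℝ} {a b : K.Cell} (h : K.RPath f r a b) : f b = r := by
  obtain ⟨h0, h1⟩ := h
  induction h1 with
  | refl => exact h0
  | tail _ hb _ => exact hb.2

lemma RPath.trans {f : K.Cell → ℝ} {r : ℝ} {a b c : K.Cell} (h : K.RPath f r a b)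
    (h' : K.RPath f r b c) : K.RPath f r a c := ⟨h.1, h.2.trans h'.2⟩

lemma RPath.single {f : K.Cell → ℝ} {r : ℝ} {a b : K.Cell} (ha : f a = r) (hb : f b = r)
    (h : K.Adjacent a b) : K.RPath f r a b := ⟨ha, Relation.ReflTransGen.single ⟨h, hb⟩⟩

lemma RPath.symm {f : K.Cell → ℝ} {r : ℝ} {a b : K.Cell} (h : K.RPath f r a b) :
    K.RPath f r b a := by
  obtain ⟨h0, h1⟩ := h
  induction h1 with
  | refl => exact ⟨h0, Relation.ReflTransGen.refl⟩
  | @tail b c hab hbc ih =>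
    have hb : f b = r := RPath.val K (a := a) ⟨h0, hab⟩
    exact (RPath.single K hbc.2 hb (Or.symm hbc.1)).trans K ih

lemma isCollection_component (f : K.Cell → ℝ) (τ : K.Cell) :
    K.IsCollection f {ρ | K.RPath f (f τ) τ ρ} := by
  refine ⟨⟨f τ, fun σ hσ => RPath.val K hσ, fun a ha b hb => (RPath.symm K ha).trans K hb⟩, ?_⟩
  rintro C' hsub ⟨c, hc, hp⟩
  have hτ : τ ∈ C' := hsub ⟨rfl, Relation.ReflTransGen.refl⟩
  refine Subset.antisymm (fun ρ hρ => ?_) hsub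
  have := hp τ hτ ρ hρ
  rw [← hc τ hτ] at this
  exact this

lemma mem_collection_of_adjacent {f : K.Cell → ℝ} {C : Set K.Cell} (hC : K.IsCollection f C)
    {σ τ : K.Cell} (hσ : σ ∈ C) (h : K.Adjacent σ τ) (hf : f σ = f τ) : τ ∈ C := by
  obtain ⟨⟨c, hc, hp⟩, hmax⟩ := hC
  have hσc := hc σ hσ
  have hcoll := K.isCollection_component f σ
  have hsub : C ⊆ {ρ | K.RPath f (f σ) σ ρ} := fun ρ hρ => by
    have := hp σ hσ ρ hρ
    rw [← hσc] at this
    exact this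
  have := hmax _ hsub hcoll.1
  rw [← this]
  exact RPath.single K rfl hf.symm h

end Collections
end CWComplexCells

/-- step in the proof of Lemma `lemupnon`: for a discrete Morse–Bott
function `f`, a collection `C`, an upward noncritical cell `σ ∈ C`, and a cell `ν ∈ C`
with `ν ≺ σ`, there is a cell `σ̃` with `ν ≺ σ̃` and `f ν > f σ̃`. -/
theorem exists_strict_upper_facet_of_upward_noncritical {X : Type} [TopologicalSpace X]
    [T2Space X] (K : CWComplexCells X) (f : K.Cell → ℝ) (hf : K.DiscreteMorseBott f)
    (C : Set K.Cell) (hC : K.IsCollection f C) (σ : K.Cell) (hσ : σ ∈ C)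
    (hup : K.UC f C σ = 1) (ν : K.Cell) (hν : ν ∈ C) (hνσ : K.Facet ν σ) :
    ∃ σ' : K.Cell, K.Facet ν σ' ∧ f ν > f σ' := by
  obtain ⟨τ, hτ⟩ := Set.encard_eq_one.1 hup
  have hτm : τ ∈ K.UCset f C σ := by rw [hτ]; rfl
  obtain ⟨hτC, hστ, hle⟩ := hτm
  have hfeq : f ν = f σ := by
    obtain ⟨⟨c, hc, -⟩, -⟩ := hC
    rw [hc ν hν, hc σ hσ]
  have hlt : f τ < f σ := by
    refine lt_of_le_of_ne hle fun h => hτC ?_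
    exact K.mem_collection_of_adjacent hC hσ (Or.inl hστ) h.symm
  by_contra hcon
  push Not at hcon
  have r1 : K.RegularFace σ τ := by
    by_contra h
    exact absurd ((hf C hC σ hσ).1 τ ⟨hστ.1, h⟩) (not_lt.2 hle)
  have r2 : K.RegularFace ν σ := by
    by_contra h
    exact absurd ((hf C hC ν hν).1 σ ⟨hνσ.1, h⟩) (not_lt.2 hfeq.ge)
  refine K.core hνσ hστ r1 r2 fun j hjσ hνj hjτ => ?_
  have hj := hcon j hνj
  have hC' := K.isCollection_component f τ
  have hD := (hf _ hC' τ ⟨rfl, Relation.ReflTransGen.refl⟩).2.2.2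
  have hmem : ∀ i, K.Facet i τ → f τ < f i → i ∈ K.DCset f {ρ | K.RPath f (f τ) τ ρ} τ :=
    fun i hi hfi => ⟨fun h => by
      have := CWComplexCells.RPath.val K h
      linarith, hi, hfi.le⟩
  exact hjσ (Set.encard_le_one_iff.1 hD j σ (hmem j hjτ (by linarith)) (hmem σ hστ hlt))
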